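/- Assume that the operator P and the function f are periodic in the m-th variable with the same period l_m. If there exists a bounded function v on ℝ^{N+1} with inf_{ℝ^{N+1}} v > 0 satisfying Pv = φ on ℝ^N × ℝ for some nonnegative function φ ∈ L^∞(ℝ^{N+1}), then any bounded solution u of Pu = f is periodic in the m-th variable with period l_m. -/

import Mathlib

open Filter Topology

noncomputable section

/-- First-order spatial partial derivative in the direction `i`. -/
def pd {N : ℕ} (i : Fin N) (φ : (Fin N → ℝ) → ℝ) (x : Fin N → ℝ) : ℝ :=
  fderiv ℝ φ x (Pi.single i 1)

/-- Second-order spatial partial derivative `∂ᵢⱼ`. -/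
def pd2 {N : ℕ} (i j : Fin N) (φ : (Fin N → ℝ) → ℝ) (x : Fin N → ℝ) : ℝ :=
  pd i (fun y => pd j φ y) x

/-- The parabolic operator `P u = ∂ₜ u − aᵢⱼ ∂ᵢⱼ u − bᵢ ∂ᵢ u − c u`. -/
def parOp {N : ℕ} (a : Fin N → Fin N → (Fin N → ℝ) → ℝ → ℝ)
    (b : Fin N → (Fin N → ℝ) → ℝ → ℝ) (c : (Fin N → ℝ) → ℝ → ℝ)
    (u : (Fin N → ℝ) → ℝ → ℝ) (x : Fin N → ℝ) (t : ℝ) : ℝ :=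
  deriv (fun s => u x s) t
    - (∑ i, ∑ j, a i j x t * pd2 i j (fun y => u y t) x)
    - (∑ i, b i x t * pd i (fun y => u y t) x)
    - c x t * u x t

/-- A bounded function on `ℝ^N × ℝ`. -/
def Bdd2 {N : ℕ} (φ : (Fin N → ℝ) → ℝ → ℝ) : Prop :=
  ∃ M : ℝ, ∀ x t, |φ x t| ≤ M

/-- A uniformly continuous function on `ℝ^N × ℝ`. -/
def UC2 {N : ℕ} (φ : (Fin N → ℝ) → ℝ → ℝ) : Prop :=
  UniformContinuous fun p : (Fin N → ℝ) × ℝ => φ p.1 p.2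

/-- Standing assumptions on the coefficients of `P`: `a`, `b` bounded and uniformly
continuous, `c` bounded and measurable, `(aᵢⱼ)` symmetric and uniformly elliptic. -/
def StdCoeffs {N : ℕ} (a : Fin N → Fin N → (Fin N → ℝ) → ℝ → ℝ)
    (b : Fin N → (Fin N → ℝ) → ℝ → ℝ) (c : (Fin N → ℝ) → ℝ → ℝ) : Prop :=
  (∀ i j, Bdd2 (a i j)) ∧ (∀ i j, UC2 (a i j)) ∧
  (∀ i, Bdd2 (b i)) ∧ (∀ i, UC2 (b i)) ∧
  Bdd2 c ∧ Measurable (fun p : (Fin N → ℝ) × ℝ => c p.1 p.2) ∧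
  (∀ i j x t, a i j x t = a j i x t) ∧
  (∃ a₀ a₁ : ℝ, 0 < a₀ ∧ a₀ ≤ a₁ ∧ ∀ (x : Fin N → ℝ) (t : ℝ) (ξ : Fin N → ℝ),
    a₀ * ∑ i, ξ i ^ 2 ≤ ∑ i, ∑ j, a i j x t * ξ i * ξ j ∧
    ∑ i, ∑ j, a i j x t * ξ i * ξ j ≤ a₁ * ∑ i, ξ i ^ 2)

/-- Regularity required of entire solutions (classical reading of the notion of
solution used in the paper). -/
def RegSol {N : ℕ} (u : (Fin N → ℝ) → ℝ → ℝ) : Prop :=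
  Continuous (fun p : (Fin N → ℝ) × ℝ => u p.1 p.2) ∧
  (∀ x, Differentiable ℝ fun s => u x s) ∧
  (∀ t, ContDiff ℝ 2 fun y => u y t)

/-- `u` is an entire solution of `P u = f` on `ℝ^N × ℝ`. -/
def IsSol {N : ℕ} (a : Fin N → Fin N → (Fin N → ℝ) → ℝ → ℝ)
    (b : Fin N → (Fin N → ℝ) → ℝ → ℝ) (c : (Fin N → ℝ) → ℝ → ℝ)
    (f u : (Fin N → ℝ) → ℝ → ℝ) : Prop :=
  RegSol u ∧ ∀ x t, parOp a b c u x t = f x t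

/-- Periodicity, with period `l`, in the `m`-th of the `N+1` space-time variables:
if `m ≤ N` this is periodicity in the space direction `x_m`, if `m = N+1` it is
periodicity in time. -/
def PerInVar {N : ℕ} (m : Fin (N + 1)) (l : ℝ) (φ : (Fin N → ℝ) → ℝ → ℝ) : Prop :=
  if h : (m : ℕ) < N then ∀ x t, φ (x + Pi.single (⟨(m : ℕ), h⟩ : Fin N) l) t = φ x t
  else ∀ x t, φ x (t + l) = φ x t

namespace Aux

/-- Euclidean square norm. -/
def sq {N : ℕ} (x : Fin N → ℝ) : ℝ := ∑ i, x i ^ 2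

lemma sq_nonneg' {N : ℕ} (x : Fin N → ℝ) : 0 ≤ sq x :=
  Finset.sum_nonneg fun _ _ => sq_nonneg _

lemma coord_sq_le {N : ℕ} (x : Fin N → ℝ) (i : Fin N) : x i ^ 2 ≤ sq x :=
  Finset.single_le_sum (f := fun i => x i ^ 2) (fun _ _ => sq_nonneg _) (Finset.mem_univ i)

lemma sq_line {N : ℕ} (d ζ : Fin N → ℝ) (s : ℝ) :
    sq (d + s • ζ) = sq d + 2 * s * (∑ i, d i * ζ i) + s ^ 2 * sq ζ := by
  simp only [sq, Finset.mul_sum, ← Finset.sum_add_distrib]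
  refine Finset.sum_congr rfl fun i _ => ?_
  simp; ring

lemma continuous_sq {N : ℕ} : Continuous (sq : (Fin N → ℝ) → ℝ) := by
  unfold sq; fun_prop

lemma sq_pos {N : ℕ} {x : Fin N → ℝ} (h : x ≠ 0) : 0 < sq x := by
  obtain ⟨i, hi⟩ := Function.ne_iff.1 h
  exact lt_of_lt_of_le (by have : x i ≠ 0 := hi
                           positivity) (coord_sq_le x i)

lemma fderiv_eq_sum {N : ℕ} (F : (Fin N → ℝ) → ℝ) (x ζ : Fin N → ℝ) :
    fderiv ℝ F x ζ = ∑ i, ζ i * pd i F x := by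
  conv_lhs => rw [← Finset.univ_sum_single ζ]
  rw [map_sum]
  refine Finset.sum_congr rfl fun i _ => ?_
  have : (Pi.single i (ζ i) : Fin N → ℝ) = ζ i • Pi.single i (1 : ℝ) := by
    rw [← Pi.single_smul]; simp
  rw [this, map_smul]; rfl

lemma line1 {N : ℕ} {F : (Fin N → ℝ) → ℝ} (hF : Differentiable ℝ F) (x ζ : Fin N → ℝ) (s : ℝ) :
    HasDerivAt (fun s : ℝ => F (x + s • ζ)) (∑ i, ζ i * pd i F (x + s • ζ)) s := by
  rw [← fderiv_eq_sum]
  have h1 : HasDerivAt (fun s : ℝ => x + s • ζ) ζ s := by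
    simpa using ((hasDerivAt_id s).smul_const ζ).const_add x
  exact (hF _).hasFDerivAt.comp_hasDerivAt s h1

lemma pd_diff {N : ℕ} {F : (Fin N → ℝ) → ℝ} (hF : ContDiff ℝ 2 F) (i : Fin N) :
    Differentiable ℝ (fun y => pd i F y) := by
  have : ContDiff ℝ 1 (fderiv ℝ F) := hF.fderiv_right (by norm_num)
  exact (this.differentiable (by norm_num)).clm_apply (differentiable_const _)

lemma line2 {N : ℕ} {F : (Fin N → ℝ) → ℝ} (hF : ContDiff ℝ 2 F) (x ζ : Fin N → ℝ) :
    HasDerivAt (fun s : ℝ => ∑ i, ζ i * pd i F (x + s • ζ))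
      (∑ i, ∑ j, pd2 i j F x * ζ i * ζ j) 0 := by
  have : ∀ j, HasDerivAt (fun s : ℝ => ζ j * pd j F (x + s • ζ))
      (ζ j * ∑ i, ζ i * pd2 i j F x) 0 := by
    intro j
    have := line1 (pd_diff hF j) x ζ 0
    simp only [zero_smul, add_zero] at this
    exact this.const_mul (ζ j)
  have h := HasDerivAt.fun_sum (u := Finset.univ) fun j _ => this j
  refine h.congr_deriv ?_
  symm
  rw [Finset.sum_comm]
  refine Finset.sum_congr rfl fun i _ => ?_
  rw [Finset.mul_sum]
  refine Finset.sum_congr rfl fun j _ => ?_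
  ring

lemma second_test {f f' : ℝ → ℝ} {f2 : ℝ} (h1 : ∀ᶠ s in 𝓝 0, HasDerivAt f (f' s) s)
    (h2 : HasDerivAt f' f2 0) (hmax : ∀ᶠ s in 𝓝 0, f s ≤ f 0) : f' 0 = 0 ∧ f2 ≤ 0 := by
  have hm : IsLocalMax f 0 := hmax
  have h0 : f' 0 = 0 := hm.hasDerivAt_eq_zero h1.self_of_nhds
  refine ⟨h0, ?_⟩
  by_contra hc
  push Not at hc
  have hd : deriv f =ᶠ[𝓝 0] f' := h1.mono fun s hs => hs.deriv
  have hdd : deriv (deriv f) 0 = f2 := by rw [hd.deriv_eq]; exact h2.deriv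
  have hmin : IsLocalMin f 0 := isLocalMin_of_deriv_deriv_pos (by rw [hdd]; exact hc)
    (by rw [hd.self_of_nhds, h0]) h1.self_of_nhds.continuousAt
  have hconst : f =ᶠ[𝓝 0] fun _ => f 0 := by
    filter_upwards [hmin, hmax] with s h1 h2 using le_antisymm h2 h1
  have hd0 : deriv f =ᶠ[𝓝 0] fun _ => 0 := by
    have := hconst.deriv
    simpa using this
  have : deriv (deriv f) 0 = 0 := by rw [hd0.deriv_eq]; simp
  linarith

/-- Pairing of a positive semidefinite symmetric matrix with a nonpositive form. -/
lemma psd_pair {N : ℕ} (M Q : Fin N → Fin N → ℝ) (hs : ∀ i j, M i j = M j i)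
    (hM : ∀ ξ : Fin N → ℝ, 0 ≤ ∑ i, ∑ j, M i j * ξ i * ξ j)
    (hQ : ∀ ξ : Fin N → ℝ, ∑ i, ∑ j, Q i j * ξ i * ξ j ≤ 0) :
    ∑ i, ∑ j, M i j * Q i j ≤ 0 := by
  have hp : (Matrix.of M).PosSemidef := by
    refine Matrix.PosSemidef.of_dotProduct_mulVec_nonneg ?_ ?_
    · ext i j; simp [hs i j]
    · intro ξ
      refine (hM ξ).trans_eq ?_
      simp only [dotProduct, Matrix.mulVec, Matrix.of_apply, Finset.mul_sum]
      refine Finset.sum_congr rfl fun i _ => Finset.sum_congr rfl fun j _ => ?_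
      simp; ring
  obtain ⟨n, B, hB⟩ := Matrix.posSemidef_iff_eq_sum_vecMulVec.1 hp
  have hMij : ∀ i j, M i j = ∑ k, B k i * B k j := by
    intro i j
    have := congrFun (congrFun hB i) j
    simpa [Matrix.sum_apply, Matrix.vecMulVec_apply] using this
  have : ∑ i, ∑ j, M i j * Q i j = ∑ k, ∑ i, ∑ j, Q i j * B k i * B k j := by
    rw [Finset.sum_comm (s := Finset.univ) (t := Finset.univ)
      (f := fun k i => ∑ j, Q i j * B k i * B k j)]
    refine Finset.sum_congr rfl fun i _ => ?_
    conv_rhs => rw [Finset.sum_comm]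
    refine Finset.sum_congr rfl fun j _ => ?_
    rw [hMij, Finset.sum_mul]
    refine Finset.sum_congr rfl fun k _ => ?_
    ring
  rw [this]
  exact Finset.sum_nonpos fun k _ => hQ (B k)

lemma quart_deriv (q p m : ℝ) (hq : 0 < q) :
    (∀ᶠ s in 𝓝 (0:ℝ), HasDerivAt (fun s : ℝ => (q + 2 * s * p + s ^ 2 * m) ^ (1/4 : ℝ))
      ((2 * p + 2 * s * m) * (1/4) * (q + 2 * s * p + s ^ 2 * m) ^ (-(3/4) : ℝ)) s) ∧
    HasDerivAt (fun s : ℝ =>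
      (2 * p + 2 * s * m) * (1/4) * (q + 2 * s * p + s ^ 2 * m) ^ (-(3/4) : ℝ))
      (q ^ (-(3/4) : ℝ) * (m / 2 - 3 / 4 * p ^ 2 / q)) 0 := by
  have hin : ∀ s : ℝ, HasDerivAt (fun s : ℝ => q + 2 * s * p + s ^ 2 * m) (2 * p + 2 * s * m) s := by
    intro s
    have h1 : HasDerivAt (fun s : ℝ => 2 * s * p) (2 * p) s := by
      simpa using ((hasDerivAt_id s).const_mul 2).mul_const p
    have h2 : HasDerivAt (fun s : ℝ => s ^ 2 * m) (2 * s * m) s := by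
      simpa using (hasDerivAt_pow 2 s).mul_const m
    exact (h1.const_add q).add h2
  have hpos : ∀ᶠ s in 𝓝 (0:ℝ), 0 < q + 2 * s * p + s ^ 2 * m := by
    have hc : ContinuousAt (fun s : ℝ => q + 2 * s * p + s ^ 2 * m) 0 := (hin 0).continuousAt
    refine hc.eventually (lt_mem_nhds ?_)
    simpa using hq
  constructor
  · filter_upwards [hpos] with s hs
    have := (hin s).rpow_const (p := (1/4 : ℝ)) (Or.inl hs.ne')
    convert this using 2
    norm_num
  · have h1 : HasDerivAt (fun s : ℝ => (2 * p + 2 * s * m) * (1/4)) (2 * m * (1/4)) 0 := by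
      have : HasDerivAt (fun s : ℝ => 2 * s * m) (2 * m) 0 := by
        simpa using ((hasDerivAt_id (0:ℝ)).const_mul 2).mul_const m
      exact (this.const_add (2 * p)).mul_const _
    have h2 := (hin 0).rpow_const (p := (-(3/4) : ℝ)) (Or.inl (by simpa using hq.ne'))
    have h := h1.mul h2
    refine h.congr_deriv ?_
    have e : q ^ (-(3/4) - 1 : ℝ) = q ^ (-(3/4) : ℝ) / q := by
      rw [Real.rpow_sub hq, Real.rpow_one]
    simp only [mul_zero, zero_mul, add_zero, ne_eq, OfNat.ofNat_ne_zero, not_false_eq_true, zero_pow, e]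
    field_simp
    ring

lemma form_diag {N : ℕ} (r : ℝ) (ξ : Fin N → ℝ) :
    ∑ i, ∑ j, (if i = j then r else 0) * ξ i * ξ j = r * sq ξ := by
  simp only [ite_mul, zero_mul, Finset.sum_ite_eq, Finset.mem_univ, if_true, sq, Finset.mul_sum]
  refine Finset.sum_congr rfl fun i _ => ?_
  ring

lemma form_rank {N : ℕ} (r : ℝ) (h ξ : Fin N → ℝ) :
    ∑ i, ∑ j, (r * h i * h j) * ξ i * ξ j = r * (∑ i, h i * ξ i) ^ 2 := by
  rw [_root_.sq (∑ i, h i * ξ i), Finset.sum_mul_sum, Finset.mul_sum]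
  refine Finset.sum_congr rfl fun i _ => ?_
  rw [Finset.mul_sum]
  refine Finset.sum_congr rfl fun j _ => ?_
  ring

lemma pair_diag {N : ℕ} (r : ℝ) (X : Fin N → Fin N → ℝ) :
    ∑ i, ∑ j, (if i = j then r else 0) * X i j = r * ∑ i, X i i := by
  simp only [ite_mul, zero_mul, Finset.sum_ite_eq, Finset.mem_univ, if_true, Finset.mul_sum]

lemma cauchy {N : ℕ} (h ξ : Fin N → ℝ) : (∑ i, h i * ξ i) ^ 2 ≤ sq h * sq ξ :=
  Finset.sum_mul_sq_le_sq_mul_sq _ _ _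

/-- A form with small entries is small. -/
lemma small_form {N : ℕ} (D : Fin N → Fin N → ℝ) (w : ℝ) (hD : ∀ i j, |D i j| ≤ w)
    (ξ : Fin N → ℝ) : -(N * w * sq ξ) ≤ ∑ i, ∑ j, D i j * ξ i * ξ j := by
  have h1 : ∀ i j, -(w * ((ξ i ^ 2 + ξ j ^ 2) / 2)) ≤ D i j * ξ i * ξ j := by
    intro i j
    have h0 := hD i j
    have hw : 0 ≤ w := (abs_nonneg _).trans h0
    have h2 : |ξ i * ξ j| ≤ (ξ i ^ 2 + ξ j ^ 2) / 2 := by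
      rw [abs_mul]
      nlinarith [sq_nonneg (|ξ i| - |ξ j|), sq_abs (ξ i), sq_abs (ξ j)]
    have h3 : |D i j * ξ i * ξ j| ≤ w * ((ξ i ^ 2 + ξ j ^ 2) / 2) := by
      rw [mul_assoc, abs_mul]
      exact mul_le_mul h0 h2 (abs_nonneg _) hw
    linarith [neg_abs_le (D i j * ξ i * ξ j)]
  refine le_trans (le_of_eq ?_) (Finset.sum_le_sum fun i _ => Finset.sum_le_sum fun j _ => h1 i j)
  simp only [Finset.sum_neg_distrib, ← Finset.mul_sum, ← Finset.sum_div, Finset.sum_add_distrib,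
    Finset.sum_const, Finset.card_univ, Fintype.card_fin, nsmul_eq_mul, sq]
  ring

lemma trace_le {N : ℕ} (A : Fin N → Fin N → ℝ) (w : ℝ) (hA : ∀ i j, |A i j| ≤ w) :
    ∑ i, A i i ≤ N * w := by
  refine (Finset.sum_le_sum fun i _ => (le_abs_self _).trans (hA i i)).trans_eq ?_
  simp

lemma single_form {N : ℕ} (X : Fin N → Fin N → ℝ) (k : Fin N) :
    ∑ i, ∑ j, X i j * (Pi.single k (1:ℝ) : Fin N → ℝ) i * (Pi.single k (1:ℝ) : Fin N → ℝ) j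
      = X k k := by
  simp [Pi.single_apply]

lemma sq_single {N : ℕ} (k : Fin N) (r : ℝ) : sq (Pi.single k r : Fin N → ℝ) = r ^ 2 := by
  simp [sq, Pi.single_apply]

lemma sq_neg {N : ℕ} (x : Fin N → ℝ) : sq (-x) = sq x := by simp [sq]

lemma sq_zero {N : ℕ} : sq (0 : Fin N → ℝ) = 0 := by simp [sq]

lemma sq_smul {N : ℕ} (r : ℝ) (x : Fin N → ℝ) : sq (r • x) = r ^ 2 * sq x := by
  simp [sq, mul_pow, Finset.mul_sum]

lemma linalg {N : ℕ} (A A' X Y : Fin N → Fin N → ℝ) (a₀ Λ S : ℝ) (h : Fin N → ℝ)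
    (ha : 0 < a₀) (hS : 0 ≤ S) (hh : 0 < sq h)
    (hsA : ∀ i j, A i j = A j i) (hsA' : ∀ i j, A' i j = A' j i)
    (hA' : ∀ i j, |A' i j| ≤ Λ)
    (hell : ∀ ξ : Fin N → ℝ, a₀ * sq ξ ≤ ∑ i, ∑ j, A' i j * ξ i * ξ j)
    (hD : ∀ i j, |A i j - A' i j| ≤ a₀ / (8 * (N + 1) ^ 2))
    (hXY : ∀ ξ η : Fin N → ℝ,
      ∑ i, ∑ j, X i j * ξ i * ξ j - ∑ i, ∑ j, Y i j * η i * η j ≤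
        S * (sq (ξ - η) / 2 - 3 / 4 * (∑ i, h i * (ξ - η) i) ^ 2 / sq h) + 2 * sq ξ) :
    ∑ i, ∑ j, A i j * X i j - ∑ i, ∑ j, A' i j * Y i j
      ≤ -(3 / 8 * a₀ * S) + (2 * (N * Λ) + 2 * a₀) := by
  set w₀ := a₀ / (8 * ((N:ℝ) + 1) ^ 2) with hw₀
  have hw₀pos : 0 < w₀ := by positivity
  have hw₀e : w₀ * (N + 1) ^ 2 = a₀ / 8 := by rw [hw₀]; field_simp
  have hN : (0:ℝ) ≤ N := Nat.cast_nonneg N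
  set w := N * w₀ with hw
  have hwn : 0 ≤ w := by positivity
  set lam := a₀ / 2 with hlam
  have hwle : w ≤ a₀ / 2 := by nlinarith
  -- the four pieces
  have e1 : ∑ i, ∑ j, (A' i j - (if i = j then w else 0) - (lam / sq h) * h i * h j) *
      (X i j - Y i j - (if i = j then 2 else 0)) ≤ 0 := by
    apply psd_pair
    · intro i j
      rw [hsA' i j]
      by_cases hij : i = j
      · subst hij; ring
      · rw [if_neg hij, if_neg (Ne.symm hij)]; ring
    · intro ξ
      have := hell ξ
      have h2 := cauchy h ξ
      have h3 : (lam / sq h) * (∑ i, h i * ξ i) ^ 2 ≤ lam * sq ξ := by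
        rw [div_mul_eq_mul_div, div_le_iff₀ hh]
        nlinarith
      simp only [sub_mul, Finset.sum_sub_distrib]
      rw [form_diag, form_rank]
      nlinarith [sq_nonneg' ξ]
    · intro ξ
      have := hXY ξ ξ
      simp only [sub_self, sq_zero, Pi.zero_apply, mul_zero, Finset.sum_const_zero] at this
      simp only [sub_mul, Finset.sum_sub_distrib]
      rw [form_diag]
      norm_num at this
      linarith
  have e2 : (lam / sq h) * (∑ i, ∑ j, X i j * h i * h j - ∑ i, ∑ j, Y i j * h i * h j)
      ≤ -(lam * S) + 2 * lam := by
    have := hXY h (-h)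
    have e : h - -h = (2:ℝ) • h := by ext i; simp; ring
    have e' : ∑ i, h i * (h - -h) i = 2 * sq h := by
      rw [e, sq, Finset.mul_sum]
      refine Finset.sum_congr rfl fun i _ => ?_
      simp; ring
    rw [e', e, sq_smul] at this
    simp only [Pi.neg_apply, mul_neg, neg_mul, neg_neg] at this
    have e3 : S * (2 ^ 2 * sq h / 2 - 3 / 4 * (2 * sq h) ^ 2 / sq h) + 2 * sq h
      = sq h * (-S + 2) := by field_simp; ring
    rw [e3] at this
    rw [div_mul_eq_mul_div, div_le_iff₀ hh]
    have := mul_le_mul_of_nonneg_left this (show 0 ≤ lam by positivity)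
    linarith
  have e3 : ∑ i, ∑ j, (A i j - A' i j + (if i = j then w else 0)) *
      (X i j - (if i = j then (S / 2 + 2) else 0)) ≤ 0 := by
    apply psd_pair
    · intro i j
      rw [hsA' i j, hsA i j]
      by_cases hij : i = j
      · subst hij; ring
      · rw [if_neg hij, if_neg (Ne.symm hij)]
    · intro ξ
      have := small_form (fun i j => A i j - A' i j) w₀ hD ξ
      simp only [add_mul, Finset.sum_add_distrib]
      rw [form_diag]
      linarith
    · intro ξ
      have := hXY ξ 0
      simp only [Pi.zero_apply, mul_zero, Finset.sum_const_zero, sub_zero] at this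
      simp only [sub_mul, Finset.sum_sub_distrib]
      rw [form_diag]
      have h4 : 0 ≤ S * (3 / 4 * (∑ i, h i * ξ i) ^ 2 / sq h) := by positivity
      nlinarith
  have e4 : -(w * ∑ i, Y i i) ≤ w * (N * (S / 2)) := by
    have : ∀ k, - Y k k ≤ S / 2 := by
      intro k
      have := hXY 0 (Pi.single k 1)
      rw [single_form] at this
      simp only [Pi.zero_apply, mul_zero, Finset.sum_const_zero, zero_sub, sq_zero, sq_neg,
        sq_single] at this
      have h4 : 0 ≤ S * (3 / 4 * (∑ i, h i * (-(Pi.single k 1 : Fin N → ℝ)) i) ^ 2 / sq h) := by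
        positivity
      nlinarith
    have h5 : ∑ k, -Y k k ≤ N * (S / 2) :=
      (Finset.sum_le_sum fun k _ => this k).trans_eq (by simp)
    rw [Finset.sum_neg_distrib] at h5
    have := mul_le_mul_of_nonneg_left h5 hwn
    linarith
  have t1 := trace_le A' Λ hA'
  have t2 := trace_le (fun i j => A i j - A' i j) w₀ hD
  have x1 : ∑ i, ∑ j, (A' i j - (if i = j then w else 0) - (lam / sq h) * h i * h j) *
      (X i j - Y i j - (if i = j then 2 else 0)) =
      ∑ i, ∑ j, A' i j * X i j - ∑ i, ∑ j, A' i j * Y i j - w * ∑ i, X i i + w * ∑ i, Y i i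
      - (lam / sq h) * (∑ i, ∑ j, X i j * h i * h j - ∑ i, ∑ j, Y i j * h i * h j)
      - 2 * ∑ i, A' i i + 2 * (N * w) + 2 * lam := by
    have y1 : ∑ i : Fin N, ∑ j : Fin N, (if i = j then w else 0) * (if i = j then 2 else 0) = 2 * (N * w) := by
      rw [pair_diag]; simp; ring
    have y2 : ∑ i, ∑ j, ((lam / sq h) * h i * h j) * (if i = j then 2 else 0) = 2 * lam := by
      have : ∑ i, ∑ j, ((lam / sq h) * h i * h j) * (if i = j then (2:ℝ) else 0)
        = ∑ i, 2 * (lam / sq h) * h i ^ 2 := by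
        refine Finset.sum_congr rfl fun i _ => ?_
        simp only [mul_ite, mul_zero, Finset.sum_ite_eq, Finset.mem_univ, if_true]
        ring
      rw [this, ← Finset.mul_sum]
      change 2 * (lam / sq h) * sq h = 2 * lam
      field_simp
    have y3 : ∑ i, ∑ j, A' i j * (if i = j then (2:ℝ) else 0) = 2 * ∑ i, A' i i := by
      rw [← pair_diag]
      refine Finset.sum_congr rfl fun i _ => Finset.sum_congr rfl fun j _ => ?_
      ring
    have y4 : ∀ Z : Fin N → Fin N → ℝ, ∑ i, ∑ j, ((lam / sq h) * h i * h j) * Z i j =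
        (lam / sq h) * ∑ i, ∑ j, Z i j * h i * h j := by
      intro Z
      simp only [Finset.mul_sum]
      refine Finset.sum_congr rfl fun i _ => Finset.sum_congr rfl fun j _ => ?_
      ring
    simp only [sub_mul, mul_sub, Finset.sum_sub_distrib, y1, y2, y3, y4, pair_diag]
    ring
  have x3 : ∑ i, ∑ j, (A i j - A' i j + (if i = j then w else 0)) *
      (X i j - (if i = j then (S / 2 + 2) else 0)) =
      ∑ i, ∑ j, A i j * X i j - ∑ i, ∑ j, A' i j * X i j + w * ∑ i, X i i
      - (S / 2 + 2) * (∑ i, (A i i - A' i i) + N * w) := by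
    have y1 : ∑ i : Fin N, ∑ j : Fin N, (if i = j then w else 0) * (if i = j then (S / 2 + 2) else 0)
      = (S / 2 + 2) * (N * w) := by
      rw [pair_diag]; simp; ring
    have y3 : ∀ B : Fin N → Fin N → ℝ, ∑ i, ∑ j, B i j * (if i = j then (S / 2 + 2) else 0)
      = (S / 2 + 2) * ∑ i, B i i := by
      intro B
      rw [← pair_diag]
      refine Finset.sum_congr rfl fun i _ => Finset.sum_congr rfl fun j _ => ?_
      ring
    simp only [sub_mul, add_mul, mul_sub, Finset.sum_sub_distrib, Finset.sum_add_distrib, y1, y3,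
      pair_diag]
    ring
  rw [x1] at e1
  rw [x3] at e3
  have z1 : (S / 2 + 2) * (∑ i, (A i i - A' i i) + N * w) ≤ (S / 2 + 2) * (N * w₀ + N * w) := by
    refine mul_le_mul_of_nonneg_left ?_ (by positivity)
    linarith
  have z2 : N * w₀ + N * w + N * w ≤ a₀ / 4 := by
    rw [hw]; nlinarith
  have z3 : (S / 2) * (N * w₀ + N * w + N * w) ≤ (S / 2) * (a₀ / 4) :=
    mul_le_mul_of_nonneg_left z2 (by positivity)
  have z4 : 0 ≤ N * w := by positivity
  nlinarith

/-- First and second order conditions at a maximum of the doubled function. -/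
lemma max_cond {N : ℕ} (F G : (Fin N → ℝ) → ℝ) (hF : ContDiff ℝ 2 F) (hG : ContDiff ℝ 2 G)
    (L : ℝ) (x y x₀ : Fin N → ℝ) (hne : 0 < sq (x - y))
    (hmax : ∀ x' y', F x' - G y' - L * sq (x' - y') ^ (1/4 : ℝ) - sq (x' - x₀) ≤
      F x - G y - L * sq (x - y) ^ (1/4 : ℝ) - sq (x - x₀)) (ξ η : Fin N → ℝ) :
    (∑ i, ξ i * pd i F x - ∑ i, η i * pd i G y =
      (L * sq (x - y) ^ (-(3/4) : ℝ)) / 2 * (∑ i, (x - y) i * (ξ - η) i)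
        + 2 * ∑ i, (x - x₀) i * ξ i) ∧
    (∑ i, ∑ j, pd2 i j F x * ξ i * ξ j - ∑ i, ∑ j, pd2 i j G y * η i * η j ≤
      (L * sq (x - y) ^ (-(3/4) : ℝ)) *
        (sq (ξ - η) / 2 - 3 / 4 * (∑ i, (x - y) i * (ξ - η) i) ^ 2 / sq (x - y)) + 2 * sq ξ) := by
  obtain ⟨k1, k2⟩ := quart_deriv (sq (x - y)) (∑ i, (x - y) i * (ξ - η) i) (sq (ξ - η)) hne
  set q := sq (x - y)
  set p := ∑ i, (x - y) i * (ξ - η) i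
  set m := sq (ξ - η)
  have q1 : ∀ s : ℝ, HasDerivAt (fun s : ℝ => sq (x - x₀) + 2 * s * (∑ i, (x - x₀) i * ξ i)
      + s ^ 2 * sq ξ) (2 * (∑ i, (x - x₀) i * ξ i) + 2 * s * sq ξ) s := by
    intro s
    have h1 : HasDerivAt (fun s : ℝ => 2 * s * (∑ i, (x - x₀) i * ξ i))
        (2 * (∑ i, (x - x₀) i * ξ i)) s := by
      simpa using ((hasDerivAt_id s).const_mul 2).mul_const (∑ i, (x - x₀) i * ξ i)
    have h2 : HasDerivAt (fun s : ℝ => s ^ 2 * sq ξ) (2 * s * sq ξ) s := by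
      simpa using (hasDerivAt_pow 2 s).mul_const (sq ξ)
    exact (h1.const_add _).add h2
  have q2 : HasDerivAt (fun s : ℝ => 2 * (∑ i, (x - x₀) i * ξ i) + 2 * s * sq ξ) (2 * sq ξ) 0 := by
    have : HasDerivAt (fun s : ℝ => 2 * s * sq ξ) (2 * sq ξ) 0 := by
      simpa using ((hasDerivAt_id (0:ℝ)).const_mul 2).mul_const (sq ξ)
    exact this.const_add _
  have hFd := hF.differentiable (by norm_num)
  have hGd := hG.differentiable (by norm_num)
  have T := second_test
    (f := fun s : ℝ => F (x + s • ξ) - G (y + s • η) - L * (q + 2 * s * p + s ^ 2 * m) ^ (1/4 : ℝ)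
      - (sq (x - x₀) + 2 * s * (∑ i, (x - x₀) i * ξ i) + s ^ 2 * sq ξ))
    (f' := fun s : ℝ => ∑ i, ξ i * pd i F (x + s • ξ) - ∑ i, η i * pd i G (y + s • η)
      - L * ((2 * p + 2 * s * m) * (1/4) * (q + 2 * s * p + s ^ 2 * m) ^ (-(3/4) : ℝ))
      - (2 * (∑ i, (x - x₀) i * ξ i) + 2 * s * sq ξ))
    (by
      filter_upwards [k1] with s hs
      exact (((line1 hFd x ξ s).sub (line1 hGd y η s)).sub (hs.const_mul L)).sub (q1 s))
    ((((line2 hF x ξ).sub (line2 hG y η)).sub (k2.const_mul L)).sub q2)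
    (Eventually.of_forall fun s => by
      have := hmax (x + s • ξ) (y + s • η)
      have e1 : x + s • ξ - (y + s • η) = (x - y) + s • (ξ - η) := by
        rw [smul_sub]; abel
      have e2 : x + s • ξ - x₀ = (x - x₀) + s • ξ := by abel
      rw [e1, e2, sq_line, sq_line] at this
      simp only [zero_smul, add_zero, mul_zero, zero_mul, ne_eq, OfNat.ofNat_ne_zero,
        not_false_eq_true, zero_pow]
      exact this)
  obtain ⟨T1, T2⟩ := T
  constructor
  · simp only [zero_smul, add_zero, mul_zero, zero_mul, ne_eq, OfNat.ofNat_ne_zero,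
      not_false_eq_true, zero_pow] at T1
    linarith
  · linarith

set_option maxHeartbeats 1000000 in
lemma holder {N : ℕ} (a : Fin N → Fin N → (Fin N → ℝ) → ℝ → ℝ)
    (b : Fin N → (Fin N → ℝ) → ℝ → ℝ) (w : (Fin N → ℝ) → ℝ → ℝ)
    (a₀ Λ B K M : ℝ) (ha : 0 < a₀)
    (hab : ∀ i j x t, |a i j x t| ≤ Λ) (hau : ∀ i j, UC2 (a i j)) (hbb : ∀ i x t, |b i x t| ≤ B)
    (hB : 0 ≤ B) (hM : 0 ≤ M)
    (hsym : ∀ i j x t, a i j x t = a j i x t)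
    (hell : ∀ x t (ξ : Fin N → ℝ), a₀ * sq ξ ≤ ∑ i, ∑ j, a i j x t * ξ i * ξ j)
    (hreg : RegSol w) (hwM : ∀ x t, |w x t| ≤ M)
    (heq : ∀ x t, |deriv (fun s => w x s) t - (∑ i, ∑ j, a i j x t * pd2 i j (fun y => w y t) x)
      - (∑ i, b i x t * pd i (fun y => w y t) x)| ≤ K) :
    ∃ L : ℝ, 0 < L ∧ ∀ x y t, w x t - w y t ≤ L * sq (x - y) ^ (1/4 : ℝ) := by
  -- modulus of continuity of the coefficients
  obtain ⟨r₁, hr₁, hmod⟩ : ∃ r₁ > 0, ∀ i j x y t, (∀ k, |x k - y k| < r₁) →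
      |a i j x t - a i j y t| ≤ a₀ / (8 * (N + 1) ^ 2) := by
    have h1 : ∀ i j, ∃ r > 0, ∀ x y t, (∀ k, |x k - y k| < r) →
        |a i j x t - a i j y t| ≤ a₀ / (8 * (N + 1) ^ 2) := by
      intro i j
      obtain ⟨r, hr, h⟩ := Metric.uniformContinuous_iff.1 (hau i j) (a₀ / (8 * (N + 1) ^ 2))
        (by positivity)
      refine ⟨r, hr, fun x y t hxy => ?_⟩
      have := @h (x, t) (y, t) (by
        rw [Prod.dist_eq]
        simp only [dist_self]
        refine max_lt ((dist_pi_lt_iff hr).2 fun k => by simpa [Real.dist_eq] using hxy k) hr)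
      rw [Real.dist_eq] at this
      exact this.le
    choose r hr h using h1
    have : ∃ r₁ > 0, ∀ i j, r₁ ≤ r i j := by
      rcases isEmpty_or_nonempty (Fin N) with he | he
      · exact ⟨1, one_pos, fun i => (he.false i).elim⟩
      · obtain ⟨p, hp⟩ := Finite.exists_min (fun p : Fin N × Fin N => r p.1 p.2)
        exact ⟨r p.1 p.2, hr _ _, fun i j => hp (i, j)⟩
    obtain ⟨r₁, hr₁, hle⟩ := this
    exact ⟨r₁, hr₁, fun i j x y t hxy => h i j x y t fun k => (hxy k).trans_le (hle i j)⟩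
  have hN : (0:ℝ) ≤ N := Nat.cast_nonneg N
  obtain ⟨r₀, hr₀, hr₀1, hr₀r, hr₀B⟩ : ∃ r₀ : ℝ, 0 < r₀ ∧ r₀ ≤ 1 ∧ r₀ ≤ r₁ ∧
      N * B * r₀ ≤ a₀ / 8 := by
    refine ⟨min (min 1 r₁) (a₀ / (8 * (N * B + 1))), by positivity, ?_, ?_, ?_⟩
    · exact (min_le_left _ _).trans (min_le_left _ _)
    · exact (min_le_left _ _).trans (min_le_right _ _)
    · have h1 : min (min 1 r₁) (a₀ / (8 * (N * B + 1))) ≤ a₀ / (8 * (N * B + 1)) := min_le_right _ _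
      have h2 := mul_le_mul_of_nonneg_left h1 (show 0 ≤ N * B by positivity)
      refine h2.trans ?_
      rw [mul_div_assoc', div_le_div_iff₀ (by positivity) (by positivity)]
      nlinarith
  set R := 2 * M + 1 with hR
  set C := 2 * R + 2 * K + (2 * (N * Λ) + 2 * a₀) + N * (2 * B * R) with hC
  set L := |4 / a₀ * C| + 2 * M / r₀ + 1 with hL
  have hLpos : 0 < L := by positivity
  refine ⟨L, hLpos, fun x₀ y₀ t₀ => ?_⟩
  by_contra hcon
  push Not at hcon
  -- doubled function
  obtain ⟨hwc, hwt, hwx⟩ := hreg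
  let Φ : (Fin N → ℝ) × (Fin N → ℝ) × ℝ → ℝ := fun P =>
    w P.1 P.2.2 - w P.2.1 P.2.2 - L * sq (P.1 - P.2.1) ^ (1/4 : ℝ) - sq (P.1 - x₀)
      - (P.2.2 - t₀) ^ 2
  have hΦc : Continuous Φ := by
    have h1 : Continuous fun P : (Fin N → ℝ) × (Fin N → ℝ) × ℝ => w P.1 P.2.2 :=
      hwc.comp (continuous_fst.prodMk (continuous_snd.comp continuous_snd))
    have h2 : Continuous fun P : (Fin N → ℝ) × (Fin N → ℝ) × ℝ => w P.2.1 P.2.2 :=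
      hwc.comp continuous_snd
    have h3 : Continuous fun P : (Fin N → ℝ) × (Fin N → ℝ) × ℝ =>
        sq (P.1 - P.2.1) ^ (1/4 : ℝ) :=
      (continuous_sq.comp (by fun_prop)).rpow_const fun _ => Or.inr (by norm_num)
    have h4 : Continuous fun P : (Fin N → ℝ) × (Fin N → ℝ) × ℝ => sq (P.1 - x₀) :=
      continuous_sq.comp (by fun_prop)
    have h5 : Continuous fun P : (Fin N → ℝ) × (Fin N → ℝ) × ℝ => (P.2.2 - t₀) ^ 2 := by fun_prop
    exact (((h1.sub h2).sub (h3.const_mul L)).sub h4).sub h5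
  -- consequences of positivity
  have hpos : ∀ P, 0 < Φ P → (∀ i, |P.1 i - x₀ i| ≤ R) ∧ |P.2.2 - t₀| ≤ R ∧
      sq (P.1 - P.2.1) < r₀ ^ 2 ∧ 0 < sq (P.1 - P.2.1) := by
    rintro ⟨x, y, t⟩ hP
    simp only [Φ] at hP ⊢
    have h1 := abs_le.1 (hwM x t)
    have h2 := abs_le.1 (hwM y t)
    have h3 : 0 ≤ sq (x - y) ^ (1/4 : ℝ) := Real.rpow_nonneg (sq_nonneg' _) _
    have h3' : 0 ≤ L * sq (x - y) ^ (1/4 : ℝ) := by positivity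
    have h4 := sq_nonneg' (x - x₀)
    have h5 := sq_nonneg (t - t₀)
    refine ⟨fun i => ?_, ?_, ?_, ?_⟩
    · have := coord_sq_le (x - x₀) i
      simp only [Pi.sub_apply] at this
      apply abs_le_of_sq_le_sq _ (by positivity)
      nlinarith
    · apply abs_le_of_sq_le_sq _ (by positivity)
      nlinarith
    · have h6 : L * sq (x - y) ^ (1/4 : ℝ) < 2 * M := by linarith
      have h7 : 2 * M / r₀ ≤ L := by
        rw [hL]; linarith [abs_nonneg (4 / a₀ * C)]
      have h8 : 2 * M ≤ L * r₀ := by rwa [div_le_iff₀ hr₀] at h7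
      have h9 : sq (x - y) ^ (1/4 : ℝ) < r₀ := by
        by_contra hh
        push Not at hh
        nlinarith
      have h10 : sq (x - y) = (sq (x - y) ^ (1/4 : ℝ)) ^ 4 := by
        rw [← Real.rpow_natCast, ← Real.rpow_mul (sq_nonneg' _)]; norm_num
      rw [h10]
      calc (sq (x - y) ^ (1/4 : ℝ)) ^ 4 < r₀ ^ 4 := by gcongr
        _ ≤ r₀ ^ 2 := pow_le_pow_of_le_one hr₀.le hr₀1 (by norm_num)
    · apply sq_pos
      intro h0
      have : x = y := sub_eq_zero.1 h0
      subst this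
      linarith
  obtain ⟨⟨x, y, t⟩, hmax⟩ : ∃ P, ∀ P', Φ P' ≤ Φ P := by
    refine hΦc.exists_forall_ge' (x₀, y₀, t₀) ?_
    have hK : IsCompact (Metric.closedBall x₀ R ×ˢ Metric.closedBall x₀ (R + 1) ×ˢ
        Metric.closedBall t₀ R) :=
      (isCompact_closedBall _ _).prod ((isCompact_closedBall _ _).prod (isCompact_closedBall _ _))
    filter_upwards [hK.compl_mem_cocompact] with P hP
    by_contra hlt
    push Not at hlt
    have h0 : 0 < Φ (x₀, y₀, t₀) := by
      simp only [Φ, sub_self, sq_zero]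
      norm_num at hcon ⊢
      linarith
    obtain ⟨g1, g2, g3, -⟩ := hpos P (h0.trans hlt)
    have hRn : 0 ≤ R := by positivity
    refine hP ⟨?_, ?_, ?_⟩
    · rw [Metric.mem_closedBall, dist_pi_le_iff hRn]
      exact fun i => by simpa [Real.dist_eq] using g1 i
    · rw [Metric.mem_closedBall, dist_pi_le_iff (by positivity)]
      intro i
      rw [Real.dist_eq]
      have := coord_sq_le (P.1 - P.2.1) i
      simp only [Pi.sub_apply] at this
      have h1 : |P.1 i - P.2.1 i| ≤ 1 := by
        apply abs_le_of_sq_le_sq _ (by norm_num)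
        nlinarith
      have e : P.2.1 i - x₀ i = (P.1 i - x₀ i) - (P.1 i - P.2.1 i) := by ring
      rw [e]
      exact (abs_sub _ _).trans (add_le_add (g1 i) h1)
    · rw [Metric.mem_closedBall, Real.dist_eq]; exact g2
  have hΦp : 0 < Φ (x, y, t) := by
    refine lt_of_lt_of_le ?_ (hmax (x₀, y₀, t₀))
    simp only [Φ, sub_self, sq_zero]
    norm_num at hcon ⊢
    linarith
  obtain ⟨g1, g2, g3, g4⟩ := hpos _ hΦp
  simp only at g1 g2 g3 g4
  -- time derivative
  have ht : deriv (fun s => w x s) t - deriv (fun s => w y s) t = 2 * (t - t₀) := by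
    have hd : HasDerivAt (fun s => w x s - w y s - L * sq (x - y) ^ (1/4 : ℝ) - sq (x - x₀)
        - (s - t₀) ^ 2) (deriv (fun s => w x s) t - deriv (fun s => w y s) t - 2 * (t - t₀)) t := by
      have h5 : HasDerivAt (fun s : ℝ => (s - t₀) ^ 2) (2 * (t - t₀)) t := by
        have := ((hasDerivAt_id t).sub_const t₀).fun_pow 2
        simpa using this
      exact (((((hwt x) t).hasDerivAt.sub ((hwt y) t).hasDerivAt).sub_const _).sub_const _).sub h5
    have hm : IsLocalMax (fun s => w x s - w y s - L * sq (x - y) ^ (1/4 : ℝ) - sq (x - x₀)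
        - (s - t₀) ^ 2) t := Eventually.of_forall fun s => hmax (x, y, s)
    linarith [hm.hasDerivAt_eq_zero hd]
  have hcond := max_cond (fun y => w y t) (fun y => w y t) (hwx t) (hwx t) L x y x₀ g4
    (fun x' y' => by have := hmax (x', y', t); simp only [Φ] at this; linarith)
  set S := L * sq (x - y) ^ (-(3/4) : ℝ) with hS
  have hrp : 1 ≤ sq (x - y) ^ (-(3/4) : ℝ) := by
    apply Real.one_le_rpow_of_pos_of_le_one_of_nonpos g4 _ (by norm_num)
    nlinarith
  have hSL : L ≤ S := by rw [hS]; nlinarith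
  have hSpos : 0 < S := by linarith
  have hcoord : ∀ k, |x k - y k| < r₀ := by
    intro k
    apply abs_lt_of_sq_lt_sq _ hr₀.le
    have := coord_sq_le (x - y) k
    simp only [Pi.sub_apply] at this
    linarith
  have hlin := linalg (fun i j => a i j x t) (fun i j => a i j y t)
    (fun i j => pd2 i j (fun y => w y t) x) (fun i j => pd2 i j (fun y => w y t) y) a₀ Λ S (x - y)
    ha hSpos.le g4 (fun i j => hsym i j x t) (fun i j => hsym i j y t) (fun i j => hab i j y t)
    (fun ξ => hell y t ξ)
    (fun i j => hmod i j x y t fun k => (hcoord k).trans_le hr₀r)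
    (fun ξ η => (hcond ξ η).2)
  have hgx : ∀ i, pd i (fun y => w y t) x = S / 2 * (x i - y i) + 2 * (x i - x₀ i) := by
    intro i
    have := (hcond (Pi.single i 1) 0).1
    simpa [Pi.single_apply] using this
  have hgy : ∀ i, pd i (fun y => w y t) y = S / 2 * (x i - y i) := by
    intro i
    have := (hcond 0 (Pi.single i 1)).1
    simp [Pi.single_apply] at this
    linarith
  have hdrift : ∑ i, b i x t * pd i (fun y => w y t) x - ∑ i, b i y t * pd i (fun y => w y t) y
      ≤ N * (S * B * r₀ + 2 * B * R) := by
    rw [← Finset.sum_sub_distrib]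
    have : ∀ i ∈ Finset.univ, b i x t * pd i (fun y => w y t) x - b i y t * pd i (fun y => w y t) y
        ≤ S * B * r₀ + 2 * B * R := by
      intro i _
      rw [hgx, hgy]
      have u1 : |b i x t * (x i - y i)| ≤ B * r₀ := by
        rw [abs_mul]; exact mul_le_mul (hbb i x t) (hcoord i).le (abs_nonneg _) hB
      have u2 : |b i y t * (x i - y i)| ≤ B * r₀ := by
        rw [abs_mul]; exact mul_le_mul (hbb i y t) (hcoord i).le (abs_nonneg _) hB
      have u3 : |b i x t * (x i - x₀ i)| ≤ B * R := by
        rw [abs_mul]; exact mul_le_mul (hbb i x t) (g1 i) (abs_nonneg _) hB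
      have u4 := mul_le_mul_of_nonneg_left (abs_le.1 u1).2 hSpos.le
      have u5 := mul_le_mul_of_nonneg_left (abs_le.1 u2).1 hSpos.le
      have u6 := (abs_le.1 u3).2
      linarith
    refine (Finset.sum_le_sum this).trans_eq ?_
    simp
    ring
  have E1 := (abs_le.1 (heq x t)).2
  have E2 := (abs_le.1 (heq y t)).1
  have g2' := (abs_le.1 g2).1
  have hfin : a₀ / 4 * S ≤ C := by
    have : S * (N * B * r₀) ≤ S * (a₀ / 8) := mul_le_mul_of_nonneg_left hr₀B hSpos.le
    rw [hC]
    linarith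
  have hfin2 : S ≤ 4 / a₀ * C := by
    have := mul_le_mul_of_nonneg_left hfin (show 0 ≤ 4 / a₀ by positivity)
    calc S = 4 / a₀ * (a₀ / 4 * S) := by field_simp
      _ ≤ _ := this
  have : 0 ≤ 2 * M / r₀ := by positivity
  linarith [le_abs_self (4 / a₀ * C)]

lemma deriv_nonpos_of_left_min {f : ℝ → ℝ} {f' t : ℝ} (hf : HasDerivAt f f' t)
    (h : ∀ᶠ s in 𝓝[<] t, f t ≤ f s) : f' ≤ 0 := by
  have h1 : Tendsto (slope f t) (𝓝[<] t) (𝓝 f') :=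
    (hasDerivAt_iff_tendsto_slope.1 hf).mono_left
      (nhdsWithin_mono _ fun s (hs : s < t) => hs.ne)
  refine le_of_tendsto h1 ?_
  filter_upwards [h, self_mem_nhdsWithin] with s hs hst
  rw [slope_def_field]
  have : s - t < 0 := sub_neg.2 hst
  exact div_nonpos_of_nonneg_of_nonpos (by linarith) this.le

/-- First and second order conditions at a local minimum of `F - E (ρ² - |x - p|²)²`. -/
lemma min_cond {N : ℕ} (F : (Fin N → ℝ) → ℝ) (hF : ContDiff ℝ 2 F) (E r : ℝ)
    (x p : Fin N → ℝ)
    (hmin : ∀ᶠ x' in 𝓝 x, F x - E * (r - sq (x - p)) ^ 2 ≤ F x' - E * (r - sq (x' - p)) ^ 2)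
    (ζ : Fin N → ℝ) :
    (∑ i, ζ i * pd i F x = -(4 * E * (r - sq (x - p)) * ∑ i, (x - p) i * ζ i)) ∧
    E * (8 * (∑ i, (x - p) i * ζ i) ^ 2 - 4 * (r - sq (x - p)) * sq ζ)
      ≤ ∑ i, ∑ j, pd2 i j F x * ζ i * ζ j := by
  set q := sq (x - p)
  set k := ∑ i, (x - p) i * ζ i
  set m := sq ζ
  have i1 : ∀ s : ℝ, HasDerivAt (fun s : ℝ => r - (q + 2 * s * k + s ^ 2 * m))
      (-(2 * k + 2 * s * m)) s := by
    intro s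
    have h1 : HasDerivAt (fun s : ℝ => 2 * s * k) (2 * k) s := by
      simpa using ((hasDerivAt_id s).const_mul 2).mul_const k
    have h2 : HasDerivAt (fun s : ℝ => s ^ 2 * m) (2 * s * m) s := by
      simpa using (hasDerivAt_pow 2 s).mul_const m
    exact ((h1.const_add q).add h2).const_sub r
  have i2 : HasDerivAt (fun s : ℝ => -(2 * k + 2 * s * m)) (-(2 * m)) 0 := by
    have : HasDerivAt (fun s : ℝ => 2 * s * m) (2 * m) 0 := by
      simpa using ((hasDerivAt_id (0:ℝ)).const_mul 2).mul_const m
    exact (this.const_add _).neg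
  have T := second_test
    (f := fun s : ℝ => E * (r - (q + 2 * s * k + s ^ 2 * m)) ^ 2 - F (x + s • ζ))
    (f' := fun s : ℝ => E * (2 * (r - (q + 2 * s * k + s ^ 2 * m)) * (-(2 * k + 2 * s * m)))
      - ∑ i, ζ i * pd i F (x + s • ζ))
    (Eventually.of_forall fun s => by
      have := (i1 s).fun_pow 2
      have h2 := (this.const_mul E).sub (line1 (hF.differentiable (by norm_num)) x ζ s)
      refine h2.congr_deriv ?_
      simp)
    ((((((i1 0).const_mul 2).mul i2).const_mul E).sub (line2 hF x ζ)))
    (by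
      have hc : Tendsto (fun s : ℝ => x + s • ζ) (𝓝 0) (𝓝 x) := by
        have : ContinuousAt (fun s : ℝ => x + s • ζ) 0 := by fun_prop
        simpa [ContinuousAt] using this
      filter_upwards [hc.eventually hmin] with s hs
      have e2 : x + s • ζ - p = (x - p) + s • ζ := by abel
      rw [e2, sq_line] at hs
      simp only [zero_smul, add_zero, mul_zero, zero_mul, ne_eq, OfNat.ofNat_ne_zero,
        not_false_eq_true, zero_pow]
      linarith)
  obtain ⟨T1, T2⟩ := T
  simp only [zero_smul, add_zero, mul_zero, zero_mul, ne_eq, OfNat.ofNat_ne_zero,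
      not_false_eq_true, zero_pow] at T1 T2
  constructor <;> linarith

set_option maxHeartbeats 1000000 in
lemma barrier {N : ℕ} (a : Fin N → Fin N → (Fin N → ℝ) → ℝ → ℝ)
    (b : Fin N → (Fin N → ℝ) → ℝ → ℝ) (c : (Fin N → ℝ) → ℝ → ℝ) (z : (Fin N → ℝ) → ℝ → ℝ)
    (a₀ Λ B C ρ R : ℝ) (ha : 0 < a₀) (hρ : 0 < ρ) (hB : 0 ≤ B) (hR : 0 ≤ R)
    (hab : ∀ i j x t, |a i j x t| ≤ Λ) (hbb : ∀ i x t, |b i x t| ≤ B)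
    (hcb : ∀ x t, |c x t| ≤ C)
    (hsym : ∀ i j x t, a i j x t = a j i x t)
    (hell : ∀ x t (ξ : Fin N → ℝ), a₀ * sq ξ ≤ ∑ i, ∑ j, a i j x t * ξ i * ξ j)
    (hreg : RegSol z) (hz : ∀ x t, 0 ≤ z x t) (heq : ∀ x t, 0 ≤ parOp a b c z x t) :
    ∃ K : ℝ, 0 ≤ K ∧ ∀ (ε : ℝ) (x y : Fin N → ℝ) (s t : ℝ), 0 < ε → 1 ≤ t - s →
      (∀ i, |x i - y i| ≤ R) → (∀ x', sq (x' - y) ≤ ρ ^ 2 → ε ≤ z x' s) →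
      ε * Real.exp (-(K * (t - s))) ≤ z x t := by
  have hN : (0:ℝ) ≤ N := Nat.cast_nonneg N
  have hC : 0 ≤ C := (abs_nonneg _).trans (hcb 0 0)
  set C₁ := 4 * (N * (ρ * R)) + 4 * (N * Λ) + 4 * (N * (B * ρ)) + 8 * a₀ with hC₁
  set K := C + C₁ ^ 2 / (32 * a₀ * ρ ^ 2) with hK
  have hK0 : 0 ≤ K := by positivity
  have hquad : ∀ Q : ℝ, 0 ≤ (K - C) * Q ^ 2 - C₁ * Q + 8 * a₀ * ρ ^ 2 := by
    intro Q
    have e : (K - C) * Q ^ 2 - C₁ * Q + 8 * a₀ * ρ ^ 2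
        = (C₁ * Q - 16 * a₀ * ρ ^ 2) ^ 2 / (32 * a₀ * ρ ^ 2) := by
      rw [hK]; field_simp; ring
    rw [e]; positivity
  refine ⟨K, hK0, fun ε x₁ y s t₁ hε hts hxy hini => ?_⟩
  obtain ⟨hzc, hzt, hzx⟩ := hreg
  -- moving centre
  set V : Fin N → ℝ := (1 / (t₁ - s)) • (x₁ - y) with hV
  have hVR : ∀ i, |V i| ≤ R := by
    intro i
    have h1 : |V i| = (1 / (t₁ - s)) * |x₁ i - y i| := by
      simp only [hV, Pi.smul_apply, Pi.sub_apply, smul_eq_mul]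
      rw [abs_mul, abs_of_nonneg (show 0 ≤ 1 / (t₁ - s) by
        have : 0 < t₁ - s := by linarith
        positivity)]
    rw [h1]
    have h2 : 1 / (t₁ - s) ≤ 1 := by
      rw [div_le_one (by linarith)]; exact hts
    calc _ ≤ 1 * |x₁ i - y i| := mul_le_mul_of_nonneg_right h2 (abs_nonneg _)
      _ ≤ R := by rw [one_mul]; exact hxy i
  set cen : ℝ → Fin N → ℝ := fun t => y + (t - s) • V with hcen
  have hcen1 : cen t₁ = x₁ := by
    have : t₁ - s ≠ 0 := by linarith
    simp only [hcen, hV, smul_smul]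
    rw [mul_one_div_cancel this]
    simp
  have hcen0 : cen s = y := by simp [hcen]
  have hcenc : Continuous cen := by simp only [hcen]; fun_prop
  set δ := ε / ρ ^ 4 with hδ
  have hδp : 0 < δ := by positivity
  set Qf : (Fin N → ℝ) → ℝ → ℝ := fun x t => ρ ^ 2 - sq (x - cen t) with hQf
  set g : (Fin N → ℝ) → ℝ → ℝ := fun x t =>
    z x t - δ * Real.exp (-(K * (t - s))) * (Qf x t) ^ 2 with hg
  set G : (Fin N → ℝ) × ℝ → ℝ := fun P => Real.exp (-((C + 1) * (P.2 - s))) * g P.1 P.2 with hG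
  have hQc : Continuous fun P : (Fin N → ℝ) × ℝ => Qf P.1 P.2 :=
    continuous_const.sub (continuous_sq.comp (continuous_fst.sub (hcenc.comp continuous_snd)))
  have hgc : Continuous fun P : (Fin N → ℝ) × ℝ => g P.1 P.2 := by
    simp only [hg]
    exact hzc.sub ((by fun_prop : Continuous fun P : (Fin N → ℝ) × ℝ =>
      δ * Real.exp (-(K * (P.2 - s)))).mul (hQc.pow 2))
  have hGc : Continuous G := by
    simp only [hG]
    exact (by fun_prop : Continuous fun P : (Fin N → ℝ) × ℝ =>
      Real.exp (-((C + 1) * (P.2 - s)))).mul hgc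
  set Ω : Set ((Fin N → ℝ) × ℝ) := {P | s ≤ P.2 ∧ P.2 ≤ t₁ ∧ 0 ≤ Qf P.1 P.2} with hΩ
  have hΩcl : IsClosed Ω :=
    (isClosed_le continuous_const continuous_snd).inter
      ((isClosed_le continuous_snd continuous_const).inter (isClosed_le continuous_const hQc))
  have hΩcomp : IsCompact Ω := by
    have hT : IsCompact ((fun p : ℝ × (Fin N → ℝ) => (cen p.1 + p.2, p.1)) ''
        (Set.Icc s t₁ ×ˢ Metric.closedBall (0 : Fin N → ℝ) ρ)) :=
      (isCompact_Icc.prod (isCompact_closedBall _ _)).image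
        (((hcenc.comp continuous_fst).add continuous_snd).prodMk continuous_fst)
    refine hT.of_isClosed_subset hΩcl ?_
    rintro ⟨x, t⟩ ⟨h1, h2, h3⟩
    refine ⟨(t, x - cen t), ⟨⟨h1, h2⟩, ?_⟩, by simp⟩
    rw [Metric.mem_closedBall, dist_zero_right, pi_norm_le_iff_of_nonneg hρ.le]
    intro i
    rw [Real.norm_eq_abs]
    apply abs_le_of_sq_le_sq _ hρ.le
    have := coord_sq_le (x - cen t) i
    simp only [hQf] at h3
    linarith
  have hx₁Ω : (x₁, t₁) ∈ Ω := by
    refine ⟨by simp only; linarith, le_refl _, ?_⟩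
    simp only [hQf, hcen1, sub_self, sq_zero, sub_zero]
    positivity
  obtain ⟨⟨x, t⟩, ⟨hst, htt, hQ0⟩, hmin⟩ := hΩcomp.exists_isMinOn ⟨_, hx₁Ω⟩ hGc.continuousOn
  simp only at hst htt hQ0
  have hmin' : ∀ P ∈ Ω, G (x, t) ≤ G P := fun P hP => hmin hP
  -- it suffices to show that the minimum is nonnegative
  suffices hpos : 0 ≤ g x t by
    have h1 : 0 ≤ G (x₁, t₁) := le_trans (by simp only [hG]; positivity) (hmin' _ hx₁Ω)
    have h2 : 0 ≤ g x₁ t₁ := by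
      simp only [hG] at h1
      exact nonneg_of_mul_nonneg_right h1 (Real.exp_pos _)
    simp only [hg, hQf, hcen1, sub_self, sq_zero, sub_zero] at h2
    have e : δ * Real.exp (-(K * (t₁ - s))) * (ρ ^ 2) ^ 2 = ε * Real.exp (-(K * (t₁ - s))) := by
      rw [hδ]; field_simp
    linarith
  by_contra hneg
  push Not at hneg
  set Q := Qf x t with hQ
  set E := δ * Real.exp (-(K * (t - s))) with hE
  have hEp : 0 < E := by positivity
  have hQpos : 0 < Q := by
    rcases hQ0.lt_or_eq with h | h
    · exact h
    · exfalso
      have : g x t = z x t := by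
        have hq0 : Qf x t = 0 := h.symm
        simp only [hg, hq0]; ring
      linarith [hz x t]
  have hst' : s < t := by
    rcases hst.lt_or_eq with h | h
    · exact h
    · exfalso
      subst h
      have hQle : Q ≤ ρ ^ 2 := by
        simp only [hQ, hQf]; linarith [sq_nonneg' (x - cen s)]
      have h1 : ε ≤ z x s := by
        apply hini
        simp only [hQ, hQf, hcen0] at hQpos
        linarith
      have h2 : δ * Q ^ 2 ≤ ε := by
        have : Q ^ 2 ≤ ρ ^ 4 := by nlinarith
        calc δ * Q ^ 2 ≤ δ * ρ ^ 4 := by gcongr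
          _ = ε := by rw [hδ]; field_simp
      have : g x s = z x s - δ * Q ^ 2 := by simp [hg, hQ]
      linarith
  -- spatial conditions
  have hxmin : ∀ᶠ x' in 𝓝 x, z x t - E * (ρ ^ 2 - sq (x - cen t)) ^ 2
      ≤ z x' t - E * (ρ ^ 2 - sq (x' - cen t)) ^ 2 := by
    have hcc : Continuous fun x' => Qf x' t := hQc.comp (continuous_id.prodMk continuous_const)
    filter_upwards [hcc.continuousAt.eventually (lt_mem_nhds hQpos)] with x' hx'
    have := hmin' (x', t) ⟨hst, htt, hx'.le⟩
    simp only [hG] at this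
    exact le_of_mul_le_mul_left this (Real.exp_pos _)
  have hcond := min_cond (fun y => z y t) (hzx t) E (ρ ^ 2) x (cen t) hxmin
  set d := x - cen t with hd
  have hQd : ρ ^ 2 - sq d = Q := rfl
  have hpair : ∑ i, ∑ j, a i j x t * (E * (8 * d i * d j - if i = j then 4 * Q else 0)
      - pd2 i j (fun y => z y t) x) ≤ 0 := by
    apply psd_pair
    · exact fun i j => hsym i j x t
    · intro ξ
      exact le_trans (mul_nonneg ha.le (sq_nonneg' _)) (hell x t ξ)
    · intro ξ
      have h1 := (hcond ξ).2
      have e : ∑ i, ∑ j, (E * (8 * d i * d j - if i = j then 4 * Q else 0)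
          - pd2 i j (fun y => z y t) x) * ξ i * ξ j
          = E * (∑ i, ∑ j, (8 * d i * d j) * ξ i * ξ j)
            - E * (∑ i, ∑ j, (if i = j then 4 * Q else 0) * ξ i * ξ j)
            - ∑ i, ∑ j, pd2 i j (fun y => z y t) x * ξ i * ξ j := by
        simp only [Finset.mul_sum, ← Finset.sum_sub_distrib]
        refine Finset.sum_congr rfl fun i _ => Finset.sum_congr rfl fun j _ => ?_
        ring
      rw [e, form_rank, form_diag]
      rw [hQd] at h1
      linarith
  have hpair2 : ∑ i, ∑ j, a i j x t * (E * (8 * d i * d j - if i = j then 4 * Q else 0)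
      - pd2 i j (fun y => z y t) x) =
      E * (8 * ∑ i, ∑ j, a i j x t * d i * d j) - E * (4 * Q * ∑ i, a i i x t)
        - ∑ i, ∑ j, a i j x t * pd2 i j (fun y => z y t) x := by
    have hpd := pair_diag (4 * Q) (fun i j => a i j x t)
    rw [← hpd]
    simp only [Finset.mul_sum, ← Finset.sum_sub_distrib]
    refine Finset.sum_congr rfl fun i _ => Finset.sum_congr rfl fun j _ => ?_
    ring
  have hgrad : ∀ i, pd i (fun y => z y t) x = -(4 * E * Q * d i) := by
    intro i
    have := (hcond (Pi.single i 1)).1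
    rw [hQd] at this
    simpa [Pi.single_apply] using this
  -- time condition
  have hQt : HasDerivAt (fun τ => Qf x τ) (2 * ∑ i, d i * V i) t := by
    have e : (fun τ => Qf x τ) = fun τ => ρ ^ 2 - (sq d + 2 * (-(τ - t)) * (∑ i, d i * V i)
        + (-(τ - t)) ^ 2 * sq V) := by
      ext τ
      rw [← sq_line]
      simp only [hQf]
      congr 2
      simp only [hd, hcen]
      ext i
      simp
      ring
    rw [e]
    have h0 : HasDerivAt (fun τ : ℝ => -(τ - t)) (-1) t := ((hasDerivAt_id t).sub_const t).neg
    have h1 := ((h0.const_mul 2).mul_const (∑ i, d i * V i)).const_add (sq d)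
    have h2 := (h0.fun_pow 2).mul_const (sq V)
    refine ((h1.add h2).const_sub (ρ ^ 2)).congr_deriv ?_
    simp
  have hexp : ∀ k : ℝ, HasDerivAt (fun τ : ℝ => Real.exp (-(k * (τ - s))))
      (-(k * Real.exp (-(k * (t - s))))) t := by
    intro k
    have h0 : HasDerivAt (fun τ : ℝ => -(k * (τ - s))) (-k) t := by
      have := (((hasDerivAt_id t).sub_const s).const_mul k).fun_neg
      simpa using this
    refine h0.exp.congr_deriv ?_
    ring
  have hgt : HasDerivAt (fun τ => g x τ) (deriv (fun τ => z x τ) t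
      - E * (-(K * Q ^ 2) + 4 * Q * ∑ i, d i * V i)) t := by
    have h1 := ((hexp K).const_mul δ).mul (hQt.fun_pow 2)
    refine ((hzt x t).hasDerivAt.sub h1).congr_deriv ?_
    rw [hE, hQ]
    simp
    ring
  have hGt := (hexp (C + 1)).mul hgt
  have htime := deriv_nonpos_of_left_min hGt (by
    have hcc : Continuous fun τ => Qf x τ := hQc.comp (continuous_const.prodMk continuous_id)
    filter_upwards [nhdsWithin_le_nhds (hcc.continuousAt.eventually (lt_mem_nhds hQpos)),
      nhdsWithin_le_nhds (lt_mem_nhds hst'), self_mem_nhdsWithin] with τ h1 h2 h3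
    exact hmin' (x, τ) ⟨h2.le, (le_of_lt h3).trans htt, h1.le⟩)
  have htime2 : deriv (fun τ => z x τ) t - E * (-(K * Q ^ 2) + 4 * Q * ∑ i, d i * V i)
      ≤ (C + 1) * g x t := by
    have : Real.exp (-((C + 1) * (t - s))) * (deriv (fun τ => z x τ) t
      - E * (-(K * Q ^ 2) + 4 * Q * ∑ i, d i * V i))
      ≤ Real.exp (-((C + 1) * (t - s))) * ((C + 1) * g x t) := by linarith
    exact le_of_mul_le_mul_left this (Real.exp_pos _)
  -- size estimates
  have hdρ : ∀ i, |d i| ≤ ρ := by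
    intro i
    apply abs_le_of_sq_le_sq _ hρ.le
    have := coord_sq_le d i
    linarith
  have hdV : ∑ i, d i * V i ≤ N * (ρ * R) := by
    have : ∀ i ∈ Finset.univ, d i * V i ≤ ρ * R := fun i _ =>
      (le_abs_self _).trans (by
        rw [abs_mul]; exact mul_le_mul (hdρ i) (hVR i) (abs_nonneg _) hρ.le)
    exact (Finset.sum_le_sum this).trans_eq (by simp)
  have hbd : ∑ i, b i x t * d i ≤ N * (B * ρ) := by
    have : ∀ i ∈ Finset.univ, b i x t * d i ≤ B * ρ := fun i _ =>
      (le_abs_self _).trans (by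
        rw [abs_mul]; exact mul_le_mul (hbb i x t) (hdρ i) (abs_nonneg _) hB)
    exact (Finset.sum_le_sum this).trans_eq (by simp)
  have htr := trace_le (fun i j => a i j x t) Λ (fun i j => hab i j x t)
  have hel := hell x t d
  have hsub : ∑ i, b i x t * pd i (fun y => z y t) x = -(4 * E * Q * ∑ i, b i x t * d i) := by
    simp only [hgrad]
    rw [Finset.mul_sum, ← Finset.sum_neg_distrib]
    refine Finset.sum_congr rfl fun i _ => ?_
    ring
  have hpde := heq x t
  unfold parOp at hpde
  rw [hsub] at hpde
  rw [hpair2] at hpair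
  have hcx := abs_le.1 (hcb x t)
  have hzg : z x t = g x t + E * Q ^ 2 := by simp only [hg]; ring
  have hq := hquad Q
  have hsqd : sq d = ρ ^ 2 - Q := by linarith
  rw [hsqd] at hel
  -- barrier inequality
  have hbar : -(K * Q ^ 2) + 4 * Q * ∑ i, d i * V i ≤
      8 * ∑ i, ∑ j, a i j x t * d i * d j - 4 * Q * ∑ i, a i i x t
        - 4 * Q * ∑ i, b i x t * d i + c x t * Q ^ 2 := by
    have m1 := mul_le_mul_of_nonneg_left hdV hQpos.le
    have m2 := mul_le_mul_of_nonneg_left hbd hQpos.le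
    have m3 := mul_le_mul_of_nonneg_left htr hQpos.le
    have m4 := mul_le_mul_of_nonneg_right hcx.1 (sq_nonneg Q)
    rw [hC₁] at hq
    linarith
  have hbar2 := mul_le_mul_of_nonneg_left hbar hEp.le
  rw [hzg] at hpde
  have hfinal : 0 ≤ (C + 1 - c x t) * g x t := by linarith
  have : 0 < C + 1 - c x t := by linarith
  nlinarith

lemma pd_lin {N : ℕ} {F G : (Fin N → ℝ) → ℝ} (hF : Differentiable ℝ F) (hG : Differentiable ℝ G)
    (α β : ℝ) (i : Fin N) (x : Fin N → ℝ) :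
    pd i (fun y => α * F y + β * G y) x = α * pd i F x + β * pd i G x := by
  unfold pd
  have h := ((hF x).hasFDerivAt.const_mul α).add ((hG x).hasFDerivAt.const_mul β)
  have h' : fderiv ℝ (fun y => α * F y + β * G y) x = α • fderiv ℝ F x + β • fderiv ℝ G x :=
    h.fderiv
  rw [h']
  simp

lemma pd2_lin {N : ℕ} {F G : (Fin N → ℝ) → ℝ} (hF : ContDiff ℝ 2 F) (hG : ContDiff ℝ 2 G)
    (α β : ℝ) (i j : Fin N) (x : Fin N → ℝ) :
    pd2 i j (fun y => α * F y + β * G y) x = α * pd2 i j F x + β * pd2 i j G x := by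
  unfold pd2
  have : (fun y => pd j (fun y => α * F y + β * G y) y)
      = fun y => α * pd j F y + β * pd j G y := by
    ext y
    exact pd_lin (hF.differentiable (by norm_num)) (hG.differentiable (by norm_num)) α β j y
  rw [this]
  exact pd_lin (pd_diff hF j) (pd_diff hG j) α β i x

lemma reg_lin {N : ℕ} {f g : (Fin N → ℝ) → ℝ → ℝ} (hf : RegSol f) (hg : RegSol g) (α β : ℝ) :
    RegSol (fun x t => α * f x t + β * g x t) :=
  ⟨(hf.1.const_mul α).add (hg.1.const_mul β),
    fun x => ((hf.2.1 x).const_mul α).add ((hg.2.1 x).const_mul β),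
    fun t => (contDiff_const.mul (hf.2.2 t)).add (contDiff_const.mul (hg.2.2 t))⟩

lemma par_lin {N : ℕ} (a : Fin N → Fin N → (Fin N → ℝ) → ℝ → ℝ)
    (b : Fin N → (Fin N → ℝ) → ℝ → ℝ) (c : (Fin N → ℝ) → ℝ → ℝ)
    {f g : (Fin N → ℝ) → ℝ → ℝ} (hf : RegSol f) (hg : RegSol g) (α β : ℝ) (x : Fin N → ℝ) (t : ℝ) :
    parOp a b c (fun x t => α * f x t + β * g x t) x t
      = α * parOp a b c f x t + β * parOp a b c g x t := by
  unfold parOp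
  have h1 : deriv (fun s => α * f x s + β * g x s) t
      = α * deriv (fun s => f x s) t + β * deriv (fun s => g x s) t :=
    (((hf.2.1 x t).hasDerivAt.const_mul α).add ((hg.2.1 x t).hasDerivAt.const_mul β)).deriv
  have h2 : ∑ i, ∑ j, a i j x t * pd2 i j (fun y => α * f y t + β * g y t) x
      = α * ∑ i, ∑ j, a i j x t * pd2 i j (fun y => f y t) x
        + β * ∑ i, ∑ j, a i j x t * pd2 i j (fun y => g y t) x := by
    simp only [Finset.mul_sum, ← Finset.sum_add_distrib]
    refine Finset.sum_congr rfl fun i _ => Finset.sum_congr rfl fun j _ => ?_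
    rw [pd2_lin (hf.2.2 t) (hg.2.2 t)]
    ring
  have h3 : ∑ i, b i x t * pd i (fun y => α * f y t + β * g y t) x
      = α * ∑ i, b i x t * pd i (fun y => f y t) x
        + β * ∑ i, b i x t * pd i (fun y => g y t) x := by
    simp only [Finset.mul_sum, ← Finset.sum_add_distrib]
    refine Finset.sum_congr rfl fun i _ => ?_
    rw [pd_lin ((hf.2.2 t).differentiable (by norm_num))
      ((hg.2.2 t).differentiable (by norm_num))]
    ring
  rw [h1, h2, h3]
  ring

lemma reg_shift {N : ℕ} {f : (Fin N → ℝ) → ℝ → ℝ} (hf : RegSol f) (X : Fin N → ℝ) (T : ℝ) :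
    RegSol (fun x t => f (x + X) (t + T)) := by
  refine ⟨hf.1.comp (by fun_prop : Continuous fun p : (Fin N → ℝ) × ℝ => (p.1 + X, p.2 + T)),
    fun x => ?_, fun t => ?_⟩
  · exact (hf.2.1 (x + X)).comp (differentiable_id.add_const T)
  · exact (hf.2.2 (t + T)).comp (contDiff_id.add contDiff_const)

lemma pd_shift {N : ℕ} (F : (Fin N → ℝ) → ℝ) (X : Fin N → ℝ) (i : Fin N) (x : Fin N → ℝ) :
    pd i (fun y => F (y + X)) x = pd i F (x + X) := by
  unfold pd
  rw [fderiv_comp_add_right]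

lemma par_shift {N : ℕ} (a : Fin N → Fin N → (Fin N → ℝ) → ℝ → ℝ)
    (b : Fin N → (Fin N → ℝ) → ℝ → ℝ) (c : (Fin N → ℝ) → ℝ → ℝ)
    (f : (Fin N → ℝ) → ℝ → ℝ) (X : Fin N → ℝ) (T : ℝ)
    (ha : ∀ i j x t, a i j (x + X) (t + T) = a i j x t)
    (hb : ∀ i x t, b i (x + X) (t + T) = b i x t)
    (hc : ∀ x t, c (x + X) (t + T) = c x t) (x : Fin N → ℝ) (t : ℝ) :
    parOp a b c (fun x t => f (x + X) (t + T)) x t = parOp a b c f (x + X) (t + T) := by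
  unfold parOp
  have h1 : deriv (fun s => f (x + X) (s + T)) t = deriv (fun s => f (x + X) s) (t + T) :=
    deriv_comp_add_const (f := fun s => f (x + X) s) T t
  have h2 : ∀ i, pd i (fun y => f (y + X) (t + T)) x = pd i (fun y => f y (t + T)) (x + X) :=
    fun i => pd_shift (fun y => f y (t + T)) X i x
  have h3 : ∀ i j, pd2 i j (fun y => f (y + X) (t + T)) x
      = pd2 i j (fun y => f y (t + T)) (x + X) := by
    intro i j
    unfold pd2
    have : (fun y => pd j (fun y => f (y + X) (t + T)) y)
        = fun y => pd j (fun y => f y (t + T)) (y + X) := by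
      ext y; exact pd_shift (fun y => f y (t + T)) X j y
    rw [this]
    exact pd_shift (fun y => pd j (fun y => f y (t + T)) y) X i x
  simp only [h1, h2, h3, ha, hb, hc]

lemma unif_bdd {N : ℕ} {ι : Type*} [Finite ι] (f : ι → (Fin N → ℝ) → ℝ → ℝ)
    (h : ∀ i, Bdd2 (f i)) : ∃ M : ℝ, 0 ≤ M ∧ ∀ i x t, |f i x t| ≤ M := by
  choose M hM using h
  cases nonempty_fintype ι
  refine ⟨∑ i, |M i|, by positivity, fun i x t => (hM i x t).trans ((le_abs_self _).trans ?_)⟩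
  exact Finset.single_le_sum (f := fun i => |M i|) (fun _ _ => abs_nonneg _) (Finset.mem_univ i)

set_option maxHeartbeats 1000000 in
lemma main_ineq {N : ℕ}
    (a : Fin N → Fin N → (Fin N → ℝ) → ℝ → ℝ)
    (b : Fin N → (Fin N → ℝ) → ℝ → ℝ) (c : (Fin N → ℝ) → ℝ → ℝ)
    (u v φ ψ : (Fin N → ℝ) → ℝ → ℝ) (X : Fin N → ℝ) (T : ℝ) (hT : 0 ≤ T)
    (hstd : StdCoeffs a b c)
    (hvbdd : Bdd2 v)
    (hvinf : ∃ δ : ℝ, 0 < δ ∧ ∀ x t, δ ≤ v x t)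
    (hvreg : RegSol v)
    (hveq : ∀ x t, parOp a b c v x t = φ x t)
    (hφpos : ∀ x t, 0 ≤ φ x t)
    (hφbdd : Bdd2 φ)
    (hψ : ∀ x t, ψ x t = u (x + X) (t + T) - u x t)
    (hψreg : RegSol ψ) (hψeq : ∀ x t, parOp a b c ψ x t = 0)
    (hbdd : Bdd2 u) (x : Fin N → ℝ) (t : ℝ) : ψ x t ≤ 0 := by
  obtain ⟨hab, hau, hbb, -, ⟨C, hC⟩, -, hsym, a₀, a₁, ha₀, -, hell⟩ := hstd
  obtain ⟨Λ, hΛ0, hΛ⟩ := unif_bdd (fun p : Fin N × Fin N => a p.1 p.2) (fun p => hab p.1 p.2)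
  obtain ⟨B, hB0, hB⟩ := unif_bdd b hbb
  obtain ⟨M, hM⟩ := hbdd
  obtain ⟨W, hW⟩ := hvbdd
  obtain ⟨Ph, hPh⟩ := hφbdd
  obtain ⟨δ, hδ, hvδ⟩ := hvinf
  have hM0 : 0 ≤ M := (abs_nonneg _).trans (hM 0 0)
  have hC0 : 0 ≤ C := (abs_nonneg _).trans (hC 0 0)
  have hPh0 : 0 ≤ Ph := (abs_nonneg _).trans (hPh 0 0)
  have hvW : ∀ x t, v x t ≤ W := fun x t => (le_abs_self _).trans (hW x t)
  have hW0 : 0 < W := lt_of_lt_of_le hδ ((hvδ 0 0).trans (hvW 0 0))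
  have hvpos : ∀ x t, 0 < v x t := fun x t => hδ.trans_le (hvδ x t)
  have hψM : ∀ x t, |ψ x t| ≤ 2 * M := by
    intro x t
    rw [hψ]
    refine (abs_sub _ _).trans ?_
    linarith [hM (x + X) (t + T), hM x t]
  by_contra hcon
  push Not at hcon
  set A : Set ℝ := Set.range fun p : (Fin N → ℝ) × ℝ => ψ p.1 p.2 / v p.1 p.2 with hA
  have hAb : BddAbove A := by
    refine ⟨2 * M / δ, ?_⟩
    rintro _ ⟨p, rfl⟩
    simp only
    exact div_le_div₀ (by positivity) ((le_abs_self _).trans (hψM _ _)) hδ (hvδ _ _)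
  set k := sSup A with hk
  have hkle : ∀ x t, ψ x t / v x t ≤ k := fun x t => le_csSup hAb ⟨(x, t), rfl⟩
  have hkpos : 0 < k := lt_of_lt_of_le (div_pos hcon (hvpos x t)) (hkle x t)
  set z : (Fin N → ℝ) → ℝ → ℝ := fun x t => k * v x t + (-1) * ψ x t with hz
  have hz0 : ∀ x t, 0 ≤ z x t := by
    intro x t
    have := hkle x t
    rw [div_le_iff₀ (hvpos x t)] at this
    simp only [hz]; linarith
  have hzreg : RegSol z := reg_lin hvreg hψreg k (-1)
  have hzeq : ∀ x t, parOp a b c z x t = k * φ x t := by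
    intro x t
    have := par_lin a b c hvreg hψreg k (-1) x t
    rw [hveq, hψeq] at this
    rw [hz, this]; ring
  have hzM : ∀ x t, |z x t| ≤ k * W + 2 * M := by
    intro x t
    rw [abs_of_nonneg (hz0 x t)]
    simp only [hz]
    have h1 := mul_le_mul_of_nonneg_left (hvW x t) hkpos.le
    have h2 := (abs_le.1 (hψM x t)).1
    linarith
  obtain ⟨L, hL, hhol⟩ := holder a b z a₀ Λ B (k * Ph + C * (k * W + 2 * M)) (k * W + 2 * M) ha₀
    (fun i j => hΛ (i, j)) hau hB hB0 (by positivity) hsym (fun x t ξ => (hell x t ξ).1) hzreg hzM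
    (by
      intro x t
      have h1 := hzeq x t
      unfold parOp at h1
      have h2 : deriv (fun s => z x s) t
          - (∑ i, ∑ j, a i j x t * pd2 i j (fun y => z y t) x)
          - (∑ i, b i x t * pd i (fun y => z y t) x) = k * φ x t + c x t * z x t := by linarith
      rw [h2]
      refine (abs_add_le _ _).trans (add_le_add ?_ ?_)
      · rw [abs_mul, abs_of_pos hkpos]
        exact mul_le_mul_of_nonneg_left (hPh x t) hkpos.le
      · rw [abs_mul]
        exact mul_le_mul (hC x t) (hzM x t) (abs_nonneg _) hC0)
  set η := k * δ / 2 with hη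
  have hηp : 0 < η := by positivity
  set ρ := (η / (2 * L)) ^ 2 with hρ
  have hρp : 0 < ρ := by positivity
  have hρ4 : L * (ρ ^ 2) ^ (1/4 : ℝ) = η / 2 := by
    have : ρ ^ 2 = (η / (2 * L)) ^ (4:ℝ) := by
      rw [hρ, ← pow_mul]
      norm_cast
    rw [this, ← Real.rpow_mul (by positivity)]
    norm_num
    field_simp
  obtain ⟨n, hn⟩ := exists_nat_gt (2 * M / η)
  have hn' : 2 * M < n * η := by rwa [div_lt_iff₀ hηp] at hn
  obtain ⟨K, hK0, hbar⟩ := barrier a b c z a₀ Λ B C ρ (n * ‖X‖) ha₀ hρp hB0 (by positivity)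
    (fun i j => hΛ (i, j)) hB hC hsym (fun x t ξ => (hell x t ξ).1) hzreg hz0
    (fun x t => by rw [hzeq]; exact mul_nonneg hkpos.le (hφpos x t))
  set τ := 1 + n * T with hτ
  set κ := η / 2 * Real.exp (-(K * τ)) with hκ
  have hκp : 0 < κ := by positivity
  obtain ⟨_, ⟨⟨x₁, t₁⟩, rfl⟩, hx₁⟩ := exists_lt_of_lt_csSup (Set.range_nonempty _)
    (show k - κ / W < sSup A by rw [← hk]; linarith [div_pos hκp hW0])
  simp only at hx₁
  have hzs : z x₁ t₁ < κ := by
    have h1 : k - ψ x₁ t₁ / v x₁ t₁ < κ / W := by linarith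
    have h2 : z x₁ t₁ = v x₁ t₁ * (k - ψ x₁ t₁ / v x₁ t₁) := by
      have := (hvpos x₁ t₁).ne'
      simp only [hz]; field_simp; ring
    have h3 : 0 ≤ k - ψ x₁ t₁ / v x₁ t₁ := by linarith [hkle x₁ t₁]
    rw [h2]
    calc _ ≤ W * (k - ψ x₁ t₁ / v x₁ t₁) := mul_le_mul_of_nonneg_right (hvW _ _) h3
      _ < W * (κ / W) := mul_lt_mul_of_pos_left h1 hW0
      _ = κ := by field_simp
  set Y : ℕ → Fin N → ℝ := fun j => x₁ + (j : ℝ) • X with hY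
  set s : ℕ → ℝ := fun j => t₁ - τ + j * T with hs
  have hlow : ∀ j ∈ Finset.range n, η ≤ ψ (Y j) (s j) := by
    intro j hj
    have hjn : (j:ℝ) ≤ n := by exact_mod_cast (Finset.mem_range.1 hj).le
    have hjT : (j:ℝ) * T ≤ n * T := mul_le_mul_of_nonneg_right hjn hT
    have hjT0 : 0 ≤ (j:ℝ) * T := by positivity
    have hzj : z (Y j) (s j) < η := by
      by_contra hge
      push Not at hge
      have h1 : ∀ x', sq (x' - Y j) ≤ ρ ^ 2 → η / 2 ≤ z x' (s j) := by
        intro x' hx'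
        have h2 := hhol (Y j) x' (s j)
        have e : sq (Y j - x') = sq (x' - Y j) := by rw [← sq_neg, neg_sub]
        rw [e] at h2
        have h3 : sq (x' - Y j) ^ (1/4 : ℝ) ≤ (ρ ^ 2) ^ (1/4 : ℝ) :=
          Real.rpow_le_rpow (sq_nonneg' _) hx' (by norm_num)
        have h4 := mul_le_mul_of_nonneg_left h3 hL.le
        linarith
      have h5 := hbar (η / 2) x₁ (Y j) (s j) t₁ (by positivity)
        (by simp only [hs, hτ]; linarith)
        (by
          intro i
          have : x₁ i - Y j i = -((j:ℝ) * X i) := by simp [hY]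
          rw [this, abs_neg, abs_mul, abs_of_nonneg (Nat.cast_nonneg j)]
          exact mul_le_mul hjn (norm_le_pi_norm X i) (abs_nonneg _) (Nat.cast_nonneg n)) h1
      have h6 : κ ≤ η / 2 * Real.exp (-(K * (t₁ - s j))) := by
        rw [hκ]
        refine mul_le_mul_of_nonneg_left (Real.exp_le_exp.2 ?_) (by positivity)
        have : t₁ - s j ≤ τ := by simp only [hs]; linarith
        have := mul_le_mul_of_nonneg_left this hK0
        linarith
      linarith
    have h7 : k * δ ≤ k * v (Y j) (s j) := mul_le_mul_of_nonneg_left (hvδ _ _) hkpos.le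
    simp only [hz] at hzj
    linarith
  have hsum : ∑ j ∈ Finset.range n, ψ (Y j) (s j) = u (Y n) (s n) - u (Y 0) (s 0) := by
    rw [← Finset.sum_range_sub (fun j => u (Y j) (s j))]
    refine Finset.sum_congr rfl fun j _ => ?_
    rw [hψ]
    have e1 : Y j + X = Y (j + 1) := by
      simp only [hY]; push_cast; rw [add_smul, one_smul, add_assoc]
    have e2 : s j + T = s (j + 1) := by
      simp only [hs]; push_cast; ring
    rw [e1, e2]
  have h8 : n * η ≤ ∑ j ∈ Finset.range n, ψ (Y j) (s j) := by
    have := Finset.sum_le_sum hlow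
    simpa using this
  rw [hsum] at h8
  have h9 := (abs_le.1 (hM (Y n) (s n))).2
  have h10 := (abs_le.1 (hM (Y 0) (s 0))).1
  linarith

lemma main_eq {N : ℕ}
    (a : Fin N → Fin N → (Fin N → ℝ) → ℝ → ℝ)
    (b : Fin N → (Fin N → ℝ) → ℝ → ℝ) (c : (Fin N → ℝ) → ℝ → ℝ)
    (f u v φ : (Fin N → ℝ) → ℝ → ℝ) (X : Fin N → ℝ) (T : ℝ) (hT : 0 ≤ T)
    (hstd : StdCoeffs a b c)
    (haper : ∀ i j x t, a i j (x + X) (t + T) = a i j x t)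
    (hbper : ∀ i x t, b i (x + X) (t + T) = b i x t)
    (hcper : ∀ x t, c (x + X) (t + T) = c x t)
    (hfper : ∀ x t, f (x + X) (t + T) = f x t)
    (hvbdd : Bdd2 v)
    (hvinf : ∃ δ : ℝ, 0 < δ ∧ ∀ x t, δ ≤ v x t)
    (hvreg : RegSol v)
    (hveq : ∀ x t, parOp a b c v x t = φ x t)
    (hφpos : ∀ x t, 0 ≤ φ x t)
    (hφbdd : Bdd2 φ)
    (hsol : IsSol a b c f u)
    (hbdd : Bdd2 u) (x : Fin N → ℝ) (t : ℝ) : u (x + X) (t + T) = u x t := by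
  obtain ⟨hreg, heq⟩ := hsol
  have hreg1 := reg_shift hreg X T
  have heq1 : ∀ x t, parOp a b c (fun x t => u (x + X) (t + T)) x t = f x t := by
    intro x t
    rw [par_shift a b c u X T haper hbper hcper, heq, hfper]
  have hr1 := reg_lin hreg1 hreg 1 (-1)
  have hr2 := reg_lin hreg1 hreg (-1) 1
  have h1 := main_ineq a b c u v φ _ X T hT hstd hvbdd hvinf hvreg hveq hφpos hφbdd
    (fun x t => by ring) hr1
    (fun x t => by rw [par_lin a b c hreg1 hreg, heq1, heq]; ring) hbdd x t
  have h2 := main_ineq a b c (fun x t => -u x t) v φ _ X T hT hstd hvbdd hvinf hvreg hveq hφpos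
    hφbdd (fun x t => by ring) hr2
    (fun x t => by rw [par_lin a b c hreg1 hreg, heq1, heq]; ring)
    (by obtain ⟨M, hM⟩ := hbdd; exact ⟨M, fun x t => by rw [abs_neg]; exact hM x t⟩) x t
  linarith

end Aux

/-- **Lemma 2.1.**  Assume that the operator `P` and the function `f` are periodic
in the `m`-th variable with the same period `l`.  If there exists a bounded function
`v` with `inf v > 0` satisfying `P v = φ` on `ℝ^N × ℝ` for some nonnegative
`φ ∈ L^∞(ℝ^{N+1})`, then any bounded solution `u` of `P u = f` is periodic in the
`m`-th variable with period `l`. -/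
theorem lem_1per {N : ℕ}
    (a : Fin N → Fin N → (Fin N → ℝ) → ℝ → ℝ)
    (b : Fin N → (Fin N → ℝ) → ℝ → ℝ) (c : (Fin N → ℝ) → ℝ → ℝ)
    (f u v φ : (Fin N → ℝ) → ℝ → ℝ) (m : Fin (N + 1)) (l : ℝ)
    (hl : 0 < l)
    (hstd : StdCoeffs a b c)
    (haper : ∀ i j, PerInVar m l (a i j))
    (hbper : ∀ i, PerInVar m l (b i))
    (hcper : PerInVar m l c)
    (hfper : PerInVar m l f)
    (hvbdd : Bdd2 v)
    (hvinf : ∃ δ : ℝ, 0 < δ ∧ ∀ x t, δ ≤ v x t)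
    (hvreg : RegSol v)
    (hveq : ∀ x t, parOp a b c v x t = φ x t)
    (hφpos : ∀ x t, 0 ≤ φ x t)
    (hφbdd : Bdd2 φ)
    (hφmeas : Measurable fun p : (Fin N → ℝ) × ℝ => φ p.1 p.2)
    (hsol : IsSol a b c f u)
    (hbdd : Bdd2 u) :
    PerInVar m l u := by
  unfold PerInVar at *
  by_cases h : (m : ℕ) < N
  · simp only [dif_pos h] at haper hbper hcper hfper ⊢
    intro x t
    have := Aux.main_eq a b c f u v φ (Pi.single (⟨(m : ℕ), h⟩ : Fin N) l) 0 le_rfl hstd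
      (by simpa using haper) (by simpa using hbper) (by simpa using hcper) (by simpa using hfper)
      hvbdd hvinf hvreg hveq hφpos hφbdd hsol hbdd x t
    simpa using this
  · simp only [dif_neg h] at haper hbper hcper hfper ⊢
    intro x t
    have := Aux.main_eq a b c f u v φ 0 l hl.le hstd
      (by simpa using haper) (by simpa using hbper) (by simpa using hcper) (by simpa using hfper)
      hvbdd hvinf hvreg hveq hφpos hφbdd hsol hbdd x t
    simpa using this
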